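/- arXiv:2110.11705 — 15 statements merged into one kernel-verified Lean document; each statement's English description precedes it below -/
import Mathlib

section
/- Let Φ : B(K) → B(H) be a Stinespring-form operation, and define the operator-valued sesquilinear form ⟨⟨A|B⟩⟩ := Φ(A*B) − Φ(A*)Φ(B) ∈ B(H). Then for all A, B ∈ B(K): (i) ⟨⟨A|A⟩⟩ ≥ 0, and (ii) the operator Cauchy–Schwarz inequality holds: ⟨⟨A|B⟩⟩·⟨⟨B|A⟩⟩ ≤ ‖⟨⟨B|B⟩⟩‖ · ⟨⟨A|A⟩⟩ in the Loewner order on B(H). -/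
open ContinuousLinearMap in
/-- The operator Cauchy–Schwarz inequality for `⟨X, Y⟩ = X† Y`. -/
theorem ContinuousLinearMap.adjoint_comp_mul_adjoint_comp_le
    {E F : Type*}
    [NormedAddCommGroup E] [InnerProductSpace ℂ E] [CompleteSpace E]
    [NormedAddCommGroup F] [InnerProductSpace ℂ F] [CompleteSpace F] (X Y : E →L[ℂ] F) :
    (adjoint X ∘L Y) * (adjoint Y ∘L X) ≤ ‖adjoint Y ∘L Y‖ • (adjoint X ∘L X) := by
  have hmul : (adjoint X ∘L Y) * (adjoint Y ∘L X) =
      adjoint (adjoint Y ∘L X) ∘L (adjoint Y ∘L X) := by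
    rw [adjoint_comp, adjoint_adjoint]
    rfl
  rw [hmul, ContinuousLinearMap.le_def, isPositive_def']
  constructor
  · refine IsSelfAdjoint.sub ?_ ?_
    · exact (IsSelfAdjoint.all ‖adjoint Y ∘L Y‖).smul (isPositive_adjoint_comp_self X).isSelfAdjoint
    · exact (isPositive_adjoint_comp_self _).isSelfAdjoint
  · intro x
    have h : ‖adjoint Y (X x)‖ ≤ ‖Y‖ * ‖X x‖ := by
      simpa using (adjoint Y).le_opNorm (X x)
    have hr : reApplyInnerSelf (‖adjoint Y ∘L Y‖ • (adjoint X ∘L X)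
        - adjoint (adjoint Y ∘L X) ∘L (adjoint Y ∘L X)) x
        = ‖Y‖ * ‖Y‖ * ‖X x‖ ^ 2 - ‖adjoint Y (X x)‖ ^ 2 := by
      rw [norm_adjoint_comp_self, reApplyInnerSelf_apply, sub_apply, inner_sub_left, map_sub,
        smul_apply,
        ← apply_norm_sq_eq_inner_adjoint_left, RCLike.real_smul_eq_coe_smul (K := ℂ),
        inner_smul_left, RCLike.conj_ofReal, RCLike.re_ofReal_mul,
        ← apply_norm_sq_eq_inner_adjoint_left, comp_apply]
    rw [hr, sub_nonneg, ← sq, ← mul_pow]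
    gcongr

open ContinuousLinearMap in
/-- The defect operator `1 - V V†` of a contraction factors as `S† S`. -/
theorem ContinuousLinearMap.exists_one_sub_comp_adjoint_eq
    {E F : Type*}
    [NormedAddCommGroup E] [InnerProductSpace ℂ E] [CompleteSpace E]
    [NormedAddCommGroup F] [InnerProductSpace ℂ F] [CompleteSpace F]
    (V : E →L[ℂ] F) (hV : ‖V‖ ≤ 1) :
    ∃ S : F →L[ℂ] F, 1 - V ∘L adjoint V = star S * S := by
  rw [← CStarAlgebra.nonneg_iff_eq_star_mul_self, sub_nonneg]
  have hpos : 0 ≤ V ∘L adjoint V := by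
    rw [nonneg_iff_isPositive]
    exact isPositive_self_comp_adjoint V
  rw [← CStarAlgebra.norm_le_one_iff_of_nonneg _ hpos]
  refine (opNorm_comp_le V (adjoint V)).trans ?_
  rw [LinearIsometryEquiv.norm_map]
  exact mul_le_one₀ hV (norm_nonneg _) hV

/-- Positivity and the operator Cauchy–Schwarz inequality for the operator-valued
sesquilinear form `⟨⟨A|B⟩⟩ := Φ(A*B) − Φ(A*)Φ(B)` of a Stinespring-form operation. -/
theorem stmt_0
    {H K M : Type*}
    [NormedAddCommGroup H] [InnerProductSpace ℂ H] [CompleteSpace H]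
    [NormedAddCommGroup K] [InnerProductSpace ℂ K] [CompleteSpace K]
    [NormedAddCommGroup M] [InnerProductSpace ℂ M] [CompleteSpace M]
    (π : (K →L[ℂ] K) →⋆ₐ[ℂ] (M →L[ℂ] M))
    (V : H →L[ℂ] M) (hV : ‖V‖ ≤ 1)
    (Φ : (K →L[ℂ] K) → (H →L[ℂ] H))
    (hΦ : ∀ A, Φ A = (ContinuousLinearMap.adjoint V).comp ((π A).comp V))
    (sesq : (K →L[ℂ] K) → (K →L[ℂ] K) → (H →L[ℂ] H))
    (hsesq : ∀ A B, sesq A B = Φ (star A * B) - Φ (star A) * Φ B) :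
    (∀ A : K →L[ℂ] K, 0 ≤ sesq A A) ∧
    (∀ A B : K →L[ℂ] K, sesq A B * sesq B A ≤ ‖sesq B B‖ • sesq A A) := by
  obtain ⟨S, hS⟩ := V.exists_one_sub_comp_adjoint_eq hV
  have key (A B : K →L[ℂ] K) : sesq A B =
      ContinuousLinearMap.adjoint (S ∘L π A ∘L V) ∘L (S ∘L π B ∘L V) := by
    ext x
    have h := congr($hS (π B (V x)))
    simp only [ContinuousLinearMap.star_eq_adjoint, sub_apply, one_apply_eq_self,
      ContinuousLinearMap.comp_apply, mul_apply_eq_comp] at h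
    simp only [hsesq, hΦ, map_mul, map_star]
    simp only [ContinuousLinearMap.star_eq_adjoint, ContinuousLinearMap.adjoint_comp, sub_apply,
      ContinuousLinearMap.comp_apply, mul_apply_eq_comp, ← h, map_sub]
  refine ⟨fun A => ?_, fun A B => ?_⟩
  · rw [key, ContinuousLinearMap.nonneg_iff_isPositive]
    exact ContinuousLinearMap.isPositive_adjoint_comp_self _
  · rw [key, key, key, key]
    exact ContinuousLinearMap.adjoint_comp_mul_adjoint_comp_le _ _
end

section
/- Let Φ : B(K) → B(H) be a Stinespring-form operation and B ∈ B(K). (i) If Φ(B*B) = Φ(B*)Φ(B), then Φ(AB) = Φ(A)Φ(B) for all A ∈ B(K). (ii) If Φ(BB*) = Φ(B)Φ(B*), then Φ(BA) = Φ(B)Φ(A) for all A ∈ B(K). -/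
open ContinuousLinearMap in
/-- A contraction whose adjoint does not shrink `x` satisfies `V V* x = x`. -/
theorem apply_adjoint_apply_eq_of_norm_le {H M : Type*}
    [NormedAddCommGroup H] [InnerProductSpace ℂ H] [CompleteSpace H]
    [NormedAddCommGroup M] [InnerProductSpace ℂ M] [CompleteSpace M]
    {V : H →L[ℂ] M} (hV : ‖V‖ ≤ 1) {x : M} (hx : ‖x‖ ≤ ‖adjoint V x‖) :
    V (adjoint V x) = x := by
  have hle : ‖V (adjoint V x)‖ ≤ ‖adjoint V x‖ := V.le_of_opNorm_le_of_le hV le_rfl |>.trans_eq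
    (one_mul _)
  have hinner : RCLike.re (inner ℂ (V (adjoint V x)) x) = ‖adjoint V x‖ ^ 2 := by
    rw [← adjoint_inner_right, ← inner_self_eq_norm_sq (𝕜 := ℂ)]
  have hsq := norm_sub_sq (𝕜 := ℂ) (V (adjoint V x)) x
  rw [hinner] at hsq
  have h : ‖V (adjoint V x) - x‖ ^ 2 ≤ 0 := by
    nlinarith [pow_le_pow_left₀ (norm_nonneg _) hle 2, pow_le_pow_left₀ (norm_nonneg _) hx 2]
  exact sub_eq_zero.mp (norm_eq_zero.mp (pow_eq_zero_iff two_ne_zero |>.mp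
    (le_antisymm h (sq_nonneg _))))

open ContinuousLinearMap in
/-- The compression `A ↦ V* π(A) V` of a *-homomorphism by a contraction is multiplicative on all
products `A * B` as soon as it is multiplicative on `star B * B`. -/
theorem compression_mul_of_star_mul_self {H K M : Type*}
    [NormedAddCommGroup H] [InnerProductSpace ℂ H] [CompleteSpace H]
    [NormedAddCommGroup K] [InnerProductSpace ℂ K] [CompleteSpace K]
    [NormedAddCommGroup M] [InnerProductSpace ℂ M] [CompleteSpace M]
    (π : (K →L[ℂ] K) →⋆ₐ[ℂ] (M →L[ℂ] M)) {V : H →L[ℂ] M} (hV : ‖V‖ ≤ 1)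
    {Φ : (K →L[ℂ] K) → (H →L[ℂ] H)} (hΦ : ∀ A, Φ A = (adjoint V).comp ((π A).comp V))
    {B : K →L[ℂ] K} (hB : Φ (star B * B) = Φ (star B) * Φ B) (A : K →L[ℂ] K) :
    Φ (A * B) = Φ A * Φ B := by
  have hfix (h : H) : V (adjoint V (π B (V h))) = π B (V h) := by
    refine apply_adjoint_apply_eq_of_norm_le hV (le_of_eq ?_)
    have key := congrArg (fun T : H →L[ℂ] H => RCLike.re (inner ℂ (T h) h)) hB
    simp only [hΦ, map_mul, map_star] at key
    simp only [star_eq_adjoint, mul_apply_eq_comp, comp_apply, adjoint_inner_left,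
      inner_self_eq_norm_sq] at key
    rw [← adjoint_inner_right V, inner_self_eq_norm_sq] at key
    exact (sq_eq_sq₀ (norm_nonneg _) (norm_nonneg _)).mp key
  ext h
  simp [hΦ, hfix]

/-- Multiplicability: if a Stinespring-form operation is multiplicative on `B*B`
(resp. `BB*`), then it is multiplicative on `AB` (resp. `BA`) for all `A`. -/
theorem stmt_1
    {H K M : Type*}
    [NormedAddCommGroup H] [InnerProductSpace ℂ H] [CompleteSpace H]
    [NormedAddCommGroup K] [InnerProductSpace ℂ K] [CompleteSpace K]
    [NormedAddCommGroup M] [InnerProductSpace ℂ M] [CompleteSpace M]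
    (π : (K →L[ℂ] K) →⋆ₐ[ℂ] (M →L[ℂ] M))
    (V : H →L[ℂ] M) (hV : ‖V‖ ≤ 1)
    (Φ : (K →L[ℂ] K) → (H →L[ℂ] H))
    (hΦ : ∀ A, Φ A = (ContinuousLinearMap.adjoint V).comp ((π A).comp V))
    (B : K →L[ℂ] K) :
    (Φ (star B * B) = Φ (star B) * Φ B → ∀ A : K →L[ℂ] K, Φ (A * B) = Φ A * Φ B) ∧
    (Φ (B * star B) = Φ B * Φ (star B) → ∀ A : K →L[ℂ] K, Φ (B * A) = Φ B * Φ A) := by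
  refine ⟨fun h => compression_mul_of_star_mul_self π hV hΦ h, fun h A => ?_⟩
  have hstar (A : K →L[ℂ] K) : Φ (star A) = star (Φ A) := by
    rw [hΦ, hΦ, map_star]
    simp [ContinuousLinearMap.star_eq_adjoint, ContinuousLinearMap.adjoint_comp,
      ContinuousLinearMap.comp_assoc]
  have hmul := compression_mul_of_star_mul_self π hV hΦ (B := star B) (by simpa using h) (star A)
  rw [← star_mul, hstar, hstar A, hstar B, ← star_mul] at hmul
  exact star_injective hmul
end

section
/- Let Φ : B(K) → B(H) be a positive linear map (A ≥ 0 implies Φ(A) ≥ 0) with Φ(1) ≤ 1. Then for every effect A ∈ B(K) (0 ≤ A ≤ 1) and every effect B ∈ B(H) (0 ≤ B ≤ 1): ‖Φ(A²) − Φ(A)²‖ ≤ 2‖Φ(A) − B‖ + ‖B − B²‖. -/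
section CStarAlgebra

variable {R : Type*} [CStarAlgebra R] [PartialOrder R] [StarOrderedRing R]

/-- A self-adjoint element lying between `-r` and `r` has norm at most `r`. -/
theorem IsSelfAdjoint.norm_le_of_neg_le_of_le {a : R} (ha : IsSelfAdjoint a) {r : ℝ}
    (hr : 0 ≤ r) (h₁ : -algebraMap ℝ R r ≤ a) (h₂ : a ≤ algebraMap ℝ R r) : ‖a‖ ≤ r := by
  have hc : Commute (algebraMap ℝ R r) a := Algebra.commutes r a
  have hprod : 0 ≤ (algebraMap ℝ R r - a) * (algebraMap ℝ R r + a) := by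
    refine Commute.mul_nonneg (sub_nonneg.2 h₂) (neg_le_iff_add_nonneg'.1 h₁) ?_
    exact ((Commute.refl _).add_right hc).sub_left (hc.symm.add_right (Commute.refl _))
  have hsq : a * a ≤ algebraMap ℝ R (r * r) := by
    rw [← sub_nonneg, map_mul]
    convert hprod using 1
    rw [sub_mul, mul_add, mul_add, hc.eq]
    abel
  have hnorm := (CStarAlgebra.norm_le_iff_le_algebraMap (a * a) (mul_nonneg hr hr)
    ha.mul_self_nonneg).2 hsq
  rw [ha.norm_mul_self, ← sq] at hnorm
  exact (sq_le_sq₀ (norm_nonneg _) hr).1 hnorm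

/-- The map `x ↦ x - x * x` is nonexpansive on effects. -/
theorem CStarAlgebra.norm_sub_mul_self_sub_le {x b : R} (hx₀ : 0 ≤ x) (hx₁ : x ≤ 1)
    (hb₀ : 0 ≤ b) (hb₁ : b ≤ 1) :
    ‖(x - x * x) - (b - b * b)‖ ≤ ‖x - b‖ := by
  have hs : ‖1 - (x + b)‖ ≤ 1 := by
    refine IsSelfAdjoint.norm_le_of_neg_le_of_le
      ((IsSelfAdjoint.one R).sub ((IsSelfAdjoint.of_nonneg hx₀).add (.of_nonneg hb₀)))
      zero_le_one ?_ ?_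
    · rw [map_one, ← sub_nonneg]
      convert add_nonneg (sub_nonneg.2 hx₁) (sub_nonneg.2 hb₁) using 1
      abel
    · rw [map_one]
      exact sub_le_self _ (add_nonneg hx₀ hb₀)
  have key : (2 : ℝ) • ((x - x * x) - (b - b * b))
      = (1 - (x + b)) * (x - b) + (x - b) * (1 - (x + b)) := by
    rw [two_smul]
    noncomm_ring
  have h2 : 2 * ‖(x - x * x) - (b - b * b)‖ ≤ 2 * ‖x - b‖ := by
    calc 2 * ‖(x - x * x) - (b - b * b)‖
        = ‖(1 - (x + b)) * (x - b) + (x - b) * (1 - (x + b))‖ := by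
          rw [← key, norm_smul, Real.norm_ofNat]
      _ ≤ ‖1 - (x + b)‖ * ‖x - b‖ + ‖x - b‖ * ‖1 - (x + b)‖ :=
          norm_add_le_of_le (norm_mul_le _ _) (norm_mul_le _ _)
      _ ≤ 1 * ‖x - b‖ + ‖x - b‖ * 1 := by gcongr
      _ = 2 * ‖x - b‖ := by ring
  linarith

/-- An effect dominates its square. -/
theorem CStarAlgebra.mul_self_le_self {a : R} (h₀ : 0 ≤ a) (h₁ : a ≤ 1) : a * a ≤ a := by
  rw [← sub_nonneg]
  convert Commute.mul_nonneg h₀ (sub_nonneg.2 h₁)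
    ((Commute.one_right a).sub_right (Commute.refl a)) using 1
  noncomm_ring

/-- A weak form of Kadison's inequality, with `q`, `x`, `y` in the role of the images of `1`, of an
effect `a` and of `a * a` under a positive sub-unital map. -/
theorem CStarAlgebra.two_mul_mul_self_le_add {q x y : R} (hx : IsSelfAdjoint x) (hq : q ≤ 1)
    (hy : 0 ≤ y) (hyx : y ≤ x) (hxy : 0 ≤ q - x - x + y) :
    x * x + x * x ≤ x + y := by
  have h₀ := hx.conjugate_nonneg hxy
  have h₁ := ((IsSelfAdjoint.one R).sub (hx.add hx)).conjugate_nonneg (sub_nonneg.2 hyx)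
  have h₂ := ((IsSelfAdjoint.one R).sub hx).conjugate_nonneg hy
  have h₃ := hx.conjugate_nonneg (sub_nonneg.2 hq)
  rw [← sub_nonneg]
  convert add_nonneg (add_nonneg (add_nonneg h₀ h₀) h₁)
    (add_nonneg (add_nonneg h₂ h₂) (add_nonneg h₃ h₃)) using 1
  noncomm_ring

end CStarAlgebra


/-- For a positive sub-unital linear map `Φ` and effects `A`, `B`:
`‖Φ(A²) − Φ(A)²‖ ≤ 2‖Φ(A) − B‖ + ‖B − B²‖`. -/
theorem stmt_3
    {H K : Type*}
    [NormedAddCommGroup H] [InnerProductSpace ℂ H] [CompleteSpace H]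
    [NormedAddCommGroup K] [InnerProductSpace ℂ K] [CompleteSpace K]
    (Φ : (K →L[ℂ] K) →ₗ[ℂ] (H →L[ℂ] H))
    (hpos : ∀ A : K →L[ℂ] K, 0 ≤ A → 0 ≤ Φ A)
    (hsub : Φ 1 ≤ 1)
    (A : K →L[ℂ] K) (hA0 : 0 ≤ A) (hA1 : A ≤ 1)
    (B : H →L[ℂ] H) (hB0 : 0 ≤ B) (hB1 : B ≤ 1) :
    ‖Φ (A * A) - Φ A * Φ A‖ ≤ 2 * ‖Φ A - B‖ + ‖B - B * B‖ := by
  have hAA : A * A ≤ A := CStarAlgebra.mul_self_le_self hA0 hA1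
  have hmono {S T : K →L[ℂ] K} (h : S ≤ T) : Φ S ≤ Φ T := by
    rw [← sub_nonneg, ← map_sub]
    exact hpos _ (sub_nonneg.2 h)
  have hx0 : 0 ≤ Φ A := hpos A hA0
  have hx1 : Φ A ≤ 1 := (hmono hA1).trans hsub
  have hxsa : IsSelfAdjoint (Φ A) := .of_nonneg hx0
  have hy0 : 0 ≤ Φ (A * A) := hpos _ (IsSelfAdjoint.of_nonneg hA0).mul_self_nonneg
  have hyx : Φ (A * A) ≤ Φ A := hmono hAA
  have hc : 0 ≤ Φ 1 - Φ A - Φ A + Φ (A * A) := by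
    rw [← map_sub, ← map_sub, ← map_add]
    convert hpos _ ((IsSelfAdjoint.one _).sub (IsSelfAdjoint.of_nonneg hA0)).mul_self_nonneg
      using 2
    noncomm_ring
  have hquad := CStarAlgebra.two_mul_mul_self_le_add hxsa hsub hy0 hyx hc
  have hdsa : IsSelfAdjoint (Φ A - Φ A * Φ A) :=
    .of_nonneg (sub_nonneg.2 (CStarAlgebra.mul_self_le_self hx0 hx1))
  have hsa : IsSelfAdjoint (Φ (A * A) - Φ A * Φ A) :=
    (IsSelfAdjoint.of_nonneg hy0).sub (.of_nonneg hxsa.mul_self_nonneg)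
  have hdefect : ‖Φ (A * A) - Φ A * Φ A‖ ≤ ‖Φ A - Φ A * Φ A‖ := by
    refine hsa.norm_le_of_neg_le_of_le (norm_nonneg _) ?_ ?_
    · refine (neg_le_neg hdsa.le_algebraMap_norm_self).trans ?_
      rw [← sub_nonneg] at hquad ⊢
      convert hquad using 1
      abel
    · exact (sub_le_sub_right hyx _).trans hdsa.le_algebraMap_norm_self
  have hpert := CStarAlgebra.norm_sub_mul_self_sub_le hx0 hx1 hB0 hB1
  have htri := norm_le_norm_sub_add (Φ A - Φ A * Φ A) (B - B * B)
  linarith [norm_nonneg (Φ A - B)]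
end

section
/- Let C, B ∈ B(H) be bounded operators on a complex Hilbert space with C self-adjoint and B an effect (0 ≤ B ≤ 1). Then ‖CB − BC‖ ≤ ‖C‖. -/
/-- A self-adjoint element of a C⋆-algebra lying between `-r` and `r` has norm at most `r`. -/
theorem IsSelfAdjoint.norm_le_of_neg_algebraMap_le {A : Type*} [CStarAlgebra A] [PartialOrder A]
    [StarOrderedRing A] {a : A} {r : ℝ} (hr : 0 ≤ r) (ha : IsSelfAdjoint a)
    (h₁ : -algebraMap ℝ A r ≤ a) (h₂ : a ≤ algebraMap ℝ A r) : ‖a‖ ≤ r := by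
  obtain _ | _ := subsingleton_or_nontrivial A
  · simpa [Subsingleton.elim a 0] using hr
  · rw [← map_neg, algebraMap_le_iff_le_spectrum] at h₁
    rw [le_algebraMap_iff_spectrum_le] at h₂
    rcases CStarAlgebra.norm_or_neg_norm_mem_spectrum ha with h | h
    · exact h₂ _ h
    · linarith [h₁ _ h]

/-- For `C` self-adjoint and `B` an effect, `‖[C,B]‖ ≤ ‖C‖`. -/
theorem stmt_4
    {H : Type*} [NormedAddCommGroup H] [InnerProductSpace ℂ H] [CompleteSpace H]
    (C B : H →L[ℂ] H) (hC : IsSelfAdjoint C) (hB0 : 0 ≤ B) (hB1 : B ≤ 1) :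
    ‖C * B - B * C‖ ≤ ‖C‖ := by
  set e : H →L[ℂ] H := algebraMap ℝ (H →L[ℂ] H) (1 / 2) with he
  have hee : e + e = 1 := by rw [he, ← map_add]; norm_num
  have he_sa : IsSelfAdjoint e := (IsSelfAdjoint.all (1 / 2 : ℝ)).algebraMap _
  have hnorm : ‖B - e‖ ≤ 1 / 2 := by
    refine ((IsSelfAdjoint.of_nonneg hB0).sub he_sa).norm_le_of_neg_algebraMap_le
      (by norm_num) ?_ ?_
    · rw [← he, neg_le_sub_iff_le_add]
      exact le_add_of_nonneg_left hB0
    · rwa [← he, sub_le_iff_le_add, hee]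
  have hcomm : e * C = C * e := Algebra.commutes _ _
  calc ‖C * B - B * C‖ = ‖C * (B - e) - (B - e) * C‖ := by
        rw [mul_sub, sub_mul, hcomm, sub_sub_sub_cancel_right]
    _ ≤ ‖C‖ * ‖B - e‖ + ‖B - e‖ * ‖C‖ :=
        (norm_sub_le _ _).trans (add_le_add (norm_mul_le _ _) (norm_mul_le _ _))
    _ ≤ ‖C‖ := by nlinarith [norm_nonneg C]
end

section
/- Let n, p be positive natural numbers, π : Matrix (Fin n) ℂ → Matrix (Fin p) ℂ a unital star-algebra homomorphism, V an p×n complex matrix with VᴴV = 1, and define the unital Stinespring-form channel Φ(A) := Vᴴ (π A) V on Matrix (Fin n) ℂ. Suppose there is a positive definite matrix ρ with trace(ρ) = 1 such that trace(ρ · Φ(A)) = trace(ρ · A) for all A (i.e., the Schrödinger-picture channel has a faithful fixed state). Then the fixed-point set {A : Φ(A) = A} is closed under multiplication: if Φ(A) = A and Φ(B) = B then Φ(A·B) = A·B. -/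
open Matrix ComplexOrder in
/-- A positive definite weight is faithful: `tr (ρ Dᴴ D) = 0` forces `D = 0`. -/
theorem Matrix.PosDef.eq_zero_of_trace_mul_conjTranspose_mul_self
    {m n : Type*} [Fintype m] [Fintype n] [DecidableEq n]
    {ρ : Matrix n n ℂ} (hρ : ρ.PosDef) {D : Matrix m n ℂ}
    (h : (ρ * (Dᴴ * D)).trace = 0) : D = 0 := by
  obtain ⟨C, rfl⟩ : ∃ C : Matrix n n ℂ, ρ = Cᴴ * C := by
    open scoped MatrixOrder in
    exact CStarAlgebra.nonneg_iff_eq_star_mul_self.mp hρ.posSemidef.nonneg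
  have hCD : C * Dᴴ = 0 := by
    rw [← trace_conjTranspose_mul_self_eq_zero_iff, conjTranspose_mul, conjTranspose_conjTranspose,
      ← h, ← Matrix.mul_assoc (Cᴴ * C), trace_mul_comm _ D]
    simp only [Matrix.mul_assoc]
  have hD : Dᴴ = 0 := by
    rw [← Matrix.one_mul Dᴴ, ← nonsing_inv_mul _ ((isUnit_iff_isUnit_det _).mp hρ.isUnit),
      Matrix.mul_assoc, Matrix.mul_assoc, hCD, Matrix.mul_zero, Matrix.mul_zero]
  exact conjTranspose_eq_zero.mp hD


open Matrix ComplexOrder in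
/-- Lindblad: if a unital Stinespring-form matrix channel has a faithful fixed state
in the Schrödinger picture, then its fixed-point set is closed under multiplication. -/
theorem stmt_6
    {n p : ℕ} (hn : 0 < n) (hp : 0 < p)
    (π : Matrix (Fin n) (Fin n) ℂ →⋆ₐ[ℂ] Matrix (Fin p) (Fin p) ℂ)
    (V : Matrix (Fin p) (Fin n) ℂ) (hV : Vᴴ * V = 1)
    (Φ : Matrix (Fin n) (Fin n) ℂ → Matrix (Fin n) (Fin n) ℂ)
    (hΦ : ∀ A, Φ A = Vᴴ * π A * V)
    (ρ : Matrix (Fin n) (Fin n) ℂ) (hρ : ρ.PosDef) (htr : ρ.trace = 1)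
    (hfix : ∀ A, (ρ * Φ A).trace = (ρ * A).trace)
    (A B : Matrix (Fin n) (Fin n) ℂ) (hA : Φ A = A) (hB : Φ B = B) :
    Φ (A * B) = A * B := by
  have hB' : Vᴴ * π B * V = B := (hΦ B).symm.trans hB
  have hBstar : Vᴴ * (π B)ᴴ * V = Bᴴ := by
    simpa [Matrix.mul_assoc] using congrArg conjTranspose hB'
  have hπ : π (Bᴴ * B) = (π B)ᴴ * π B := by
    rw [map_mul, ← star_eq_conjTranspose, map_star, star_eq_conjTranspose]
  have hdefect : (π B * V - V * B)ᴴ * (π B * V - V * B) = Φ (Bᴴ * B) - Bᴴ * B := by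
    calc (π B * V - V * B)ᴴ * (π B * V - V * B)
        = Vᴴ * ((π B)ᴴ * π B) * V - Vᴴ * (π B)ᴴ * V * B - Bᴴ * (Vᴴ * π B * V)
          + Bᴴ * (Vᴴ * V) * B := by
          simp only [conjTranspose_sub, conjTranspose_mul, Matrix.sub_mul, Matrix.mul_sub,
            Matrix.mul_assoc]
          abel
      _ = Φ (Bᴴ * B) - Bᴴ * B := by
          rw [hΦ, hπ, hBstar, hB', hV, Matrix.mul_one]
          abel
  have hintertwine : π B * V = V * B := by
    refine sub_eq_zero.mp (hρ.eq_zero_of_trace_mul_conjTranspose_mul_self ?_)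
    rw [hdefect, Matrix.mul_sub, trace_sub, hfix, sub_self]
  calc Φ (A * B) = Vᴴ * π A * (π B * V) := by rw [hΦ, map_mul]; simp only [Matrix.mul_assoc]
    _ = Φ A * B := by rw [hintertwine, hΦ, Matrix.mul_assoc _ V B]
    _ = A * B := by rw [hA]
end

section
/- Let Φ : B(H) → B(H) be a unital Stinespring-form operation (so V*V = 1) and N ∈ B(H) self-adjoint. If Φ(N) = N and Φ(N²) = N², then Φ(Nᵏ) = Nᵏ for every natural number k ≥ 1. -/
/-- If a bounded map `T` and self-adjoint maps `A`, `N` satisfy `T* T = 1`, `T* A T = N` and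
`T* A² T = N²`, then `T` intertwines `N` and `A`. -/
theorem intertwines_of_compression_sq
    {H M : Type*}
    [NormedAddCommGroup H] [InnerProductSpace ℂ H] [CompleteSpace H]
    [NormedAddCommGroup M] [InnerProductSpace ℂ M] [CompleteSpace M]
    {T : H →L[ℂ] M} {N : H →L[ℂ] H} {A : M →L[ℂ] M}
    (hN : IsSelfAdjoint N) (hA : IsSelfAdjoint A)
    (hT : (ContinuousLinearMap.adjoint T).comp T = 1)
    (h1 : (ContinuousLinearMap.adjoint T).comp (A.comp T) = N)
    (h2 : (ContinuousLinearMap.adjoint T).comp ((A * A).comp T) = N * N) :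
    A.comp T = T.comp N := by
  have hT' (x : H) : ContinuousLinearMap.adjoint T (T x) = x := DFunLike.congr_fun hT x
  have h1' (x : H) : ContinuousLinearMap.adjoint T (A (T x)) = N x := DFunLike.congr_fun h1 x
  have h2' (x : H) : ContinuousLinearMap.adjoint T (A (A (T x))) = N (N x) :=
    DFunLike.congr_fun h2 x
  have hW : (ContinuousLinearMap.adjoint (A.comp T - T.comp N)).comp (A.comp T - T.comp N) = 0 := by
    ext x
    simp [ContinuousLinearMap.adjoint_comp, hN.adjoint_eq, hA.adjoint_eq, hT', h1', h2']
  have hnorm := ContinuousLinearMap.norm_adjoint_comp_self (A.comp T - T.comp N)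
  rw [hW, norm_zero, eq_comm, mul_self_eq_zero, norm_eq_zero] at hnorm
  exact sub_eq_zero.mp hnorm


/-- If a unital Stinespring-form operation fixes a self-adjoint `N` and `N²`,
then it fixes all powers `Nᵏ`, `k ≥ 1`. -/
theorem stmt_7
    {H M : Type*}
    [NormedAddCommGroup H] [InnerProductSpace ℂ H] [CompleteSpace H]
    [NormedAddCommGroup M] [InnerProductSpace ℂ M] [CompleteSpace M]
    (π : (H →L[ℂ] H) →⋆ₐ[ℂ] (M →L[ℂ] M))
    (V : H →L[ℂ] M) (hV : ‖V‖ ≤ 1)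
    (hunital : (ContinuousLinearMap.adjoint V).comp V = 1)
    (Φ : (H →L[ℂ] H) → (H →L[ℂ] H))
    (hΦ : ∀ A, Φ A = (ContinuousLinearMap.adjoint V).comp ((π A).comp V))
    (N : H →L[ℂ] H) (hN : IsSelfAdjoint N)
    (h1 : Φ N = N) (h2 : Φ (N * N) = N * N) :
    ∀ k : ℕ, 1 ≤ k → Φ (N ^ k) = N ^ k := by
  have hVN : (π N).comp V = V.comp N :=
    intertwines_of_compression_sq hN (hN.map π) hunital (by rw [← hΦ, h1])
      (by rw [← map_mul, ← hΦ, h2])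
  have hpow (k : ℕ) : (π (N ^ k)).comp V = V.comp (N ^ k) := by
    induction k with
    | zero => ext; simp
    | succ k ih =>
      rw [pow_succ, map_mul, ContinuousLinearMap.mul_def, ContinuousLinearMap.comp_assoc, hVN,
        ← ContinuousLinearMap.comp_assoc, ih, ContinuousLinearMap.comp_assoc,
        ContinuousLinearMap.mul_def]
  intro k _
  rw [hΦ, hpow, ← ContinuousLinearMap.comp_assoc, hunital, ContinuousLinearMap.one_def,
    ContinuousLinearMap.id_comp]
end

section
/- There exists a family of 3×3 complex matrices K : Fin 4 → Matrix (Fin 3) ℂ with ∑ᵢ (K i)ᴴ · (K i) = 1, such that the unital map Φ(A) := ∑ᵢ (K i)ᴴ · A · (K i) and the self-adjoint matrix N := diagonal(1, 0, −1) satisfy Φ(N) = N but Φ(N·N) ≠ N·N. (Hence average conservation of a quantity by a channel does not imply full conservation, even in finite dimensions.) -/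
open Matrix in
/-- Average conservation does not imply full conservation: there is a qutrit channel
(in Kraus form, Heisenberg picture) fixing `N = diag(1,0,−1)` but not `N²`. -/
theorem stmt_9 :
    ∃ K : Fin 4 → Matrix (Fin 3) (Fin 3) ℂ,
      (∑ i, (K i)ᴴ * K i) = 1 ∧
      (∑ i, (K i)ᴴ * Matrix.diagonal ![1, 0, -1] * K i) = Matrix.diagonal ![1, 0, -1] ∧
      (∑ i, (K i)ᴴ * (Matrix.diagonal ![1, 0, -1] * Matrix.diagonal ![1, 0, -1]) * K i) ≠
        Matrix.diagonal ![1, 0, -1] * Matrix.diagonal ![1, 0, -1] := by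
  -- The levels `±1` are fixed, and the level `0` decays to each of them with probability `1/2`.
  refine ⟨![!![1, 0, 0; 0, 0, 0; 0, 0, 0], !![0, 0, 0; 0, 0, 0; 0, 0, 1],
    !![0, ⟨1 / 2, 1 / 2⟩, 0; 0, 0, 0; 0, 0, 0],
    !![0, 0, 0; 0, 0, 0; 0, ⟨1 / 2, 1 / 2⟩, 0]], ?_, ?_, fun h => ?_⟩
  · ext i j
    fin_cases i <;> fin_cases j <;>
      simp [Fin.sum_univ_succ, Matrix.mul_apply, Complex.ext_iff] <;> norm_num
  · ext i j
    fin_cases i <;> fin_cases j <;>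
      simp [Fin.sum_univ_succ, Matrix.mul_apply, Matrix.diagonal_apply]
  · have h11 := congrArg Complex.re (congrFun (congrFun h 1) 1)
    norm_num [Fin.sum_univ_succ, Matrix.mul_apply, Matrix.diagonal_apply] at h11
end

section
/- Let Φ : B(K) → B(H) be a unital Stinespring-form operation (V*V = 1). Let a, b ∈ B(K) with ab = ba and a an effect (0 ≤ a ≤ 1). Then ‖[Φ(a), Φ(b)]‖ ≤ ‖Φ(a) − Φ(a)²‖^{1/2} · ( ‖Φ(b*b) − Φ(b*)Φ(b)‖^{1/2} + ‖Φ(bb*) − Φ(b)Φ(b*)‖^{1/2} ). -/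
open ContinuousLinearMap in
/-- The covariance `V* (π (x* y)) V - (V* (π x*) V) (V* (π y) V)` of a compression by an isometry
factors through the deviation operators `(π x) V - V (V* (π x) V)`. -/
theorem adjoint_deviation_comp_deviation
    {H M A : Type*} [NormedAddCommGroup H] [InnerProductSpace ℂ H] [CompleteSpace H]
    [NormedAddCommGroup M] [InnerProductSpace ℂ M] [CompleteSpace M]
    [Ring A] [StarRing A] [Algebra ℂ A]
    (π : A →⋆ₐ[ℂ] (M →L[ℂ] M)) (V : H →L[ℂ] M) (hV : (adjoint V).comp V = 1)
    (Φ : A → (H →L[ℂ] H)) (hΦ : ∀ x, Φ x = (adjoint V).comp ((π x).comp V)) (x y : A) :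
    (adjoint ((π x).comp V - V.comp (Φ x))).comp ((π y).comp V - V.comp (Φ y)) =
      Φ (star x * y) - Φ (star x) * Φ y := by
  have h1 : ∀ v, adjoint V (V v) = v := fun v => DFunLike.congr_fun hV v
  have h2 : ∀ z v, adjoint V (π z (V v)) = Φ z v := fun z v => by simp [hΦ]
  have h3 : adjoint (π x) = π (star x) := by rw [map_star, star_eq_adjoint]
  have h4 : adjoint (Φ x) = Φ (star x) := by
    simp [hΦ, adjoint_comp, h3, comp_assoc]
  ext v
  have h5 : Φ (star x * y) v = adjoint V (π (star x) (π y (V v))) := by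
    simp [hΦ]
  simp [map_sub, adjoint_comp, h3, h4, h1, h2, h5]

open ContinuousLinearMap in
/-- The norm of a product `S* T` is bounded through the norms of `S* S` and `T* T`. -/
theorem norm_adjoint_comp_le_sqrt_mul_sqrt
    {H M : Type*} [NormedAddCommGroup H] [InnerProductSpace ℂ H] [CompleteSpace H]
    [NormedAddCommGroup M] [InnerProductSpace ℂ M] [CompleteSpace M] (S T : H →L[ℂ] M) :
    ‖(adjoint S).comp T‖ ≤ √‖(adjoint S).comp S‖ * √‖(adjoint T).comp T‖ := by
  rw [norm_adjoint_comp_self, norm_adjoint_comp_self, Real.sqrt_mul_self (norm_nonneg _),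
    Real.sqrt_mul_self (norm_nonneg _)]
  simpa using opNorm_comp_le (adjoint S) T

/-- Commutation bound for images of commuting operators under a unital
Stinespring-form operation, where `a` is an effect. -/
theorem stmt_10
    {H K M : Type*}
    [NormedAddCommGroup H] [InnerProductSpace ℂ H] [CompleteSpace H]
    [NormedAddCommGroup K] [InnerProductSpace ℂ K] [CompleteSpace K]
    [NormedAddCommGroup M] [InnerProductSpace ℂ M] [CompleteSpace M]
    (π : (K →L[ℂ] K) →⋆ₐ[ℂ] (M →L[ℂ] M))
    (V : H →L[ℂ] M) (hV : ‖V‖ ≤ 1)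
    (hunital : (ContinuousLinearMap.adjoint V).comp V = 1)
    (Φ : (K →L[ℂ] K) → (H →L[ℂ] H))
    (hΦ : ∀ A, Φ A = (ContinuousLinearMap.adjoint V).comp ((π A).comp V))
    (a b : K →L[ℂ] K) (ha0 : 0 ≤ a) (ha1 : a ≤ 1) (hab : a * b = b * a) :
    ‖Φ a * Φ b - Φ b * Φ a‖ ≤
      Real.sqrt ‖Φ a - Φ a * Φ a‖ *
        (Real.sqrt ‖Φ (star b * b) - Φ (star b) * Φ b‖ +
          Real.sqrt ‖Φ (b * star b) - Φ b * Φ (star b)‖) := by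
  have hcov := adjoint_deviation_comp_deviation π V hunital Φ hΦ
  set R : (K →L[ℂ] K) → (H →L[ℂ] M) := fun x => (π x).comp V - V.comp (Φ x)
  have ha : star a = a := (IsSelfAdjoint.of_nonneg ha0).star_eq
  have hsq : 0 ≤ a - a * a := by
    have h := Commute.mul_nonneg ha0 (sub_nonneg.mpr ha1)
      ((Commute.one_right a).sub_right (Commute.refl a))
    rwa [mul_sub, mul_one] at h
  have hΦsq : Φ (a * a) ≤ Φ a := by
    have h : 0 ≤ π (a - a * a) := map_nonneg π hsq
    rw [ContinuousLinearMap.nonneg_iff_isPositive] at h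
    rw [ContinuousLinearMap.le_def]
    convert h.adjoint_conj V using 1
    rw [hΦ, hΦ, map_sub, ContinuousLinearMap.sub_comp, ContinuousLinearMap.comp_sub]
  have hvar : ‖Φ (a * a) - Φ a * Φ a‖ ≤ ‖Φ a - Φ a * Φ a‖ := by
    refine CStarAlgebra.norm_le_norm_of_nonneg_of_le ?_ (sub_le_sub_right hΦsq _)
    have h := hcov a a
    rw [ha] at h
    rw [← h, ContinuousLinearMap.nonneg_iff_isPositive]
    exact ContinuousLinearMap.isPositive_adjoint_comp_self (R a)
  have hbound₁ : ‖Φ (a * b) - Φ a * Φ b‖ ≤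
      √‖Φ (a * a) - Φ a * Φ a‖ * √‖Φ (star b * b) - Φ (star b) * Φ b‖ := by
    have h := norm_adjoint_comp_le_sqrt_mul_sqrt (R a) (R b)
    rwa [hcov, hcov, hcov, ha] at h
  have hbound₂ : ‖Φ (b * a) - Φ b * Φ a‖ ≤
      √‖Φ (b * star b) - Φ b * Φ (star b)‖ * √‖Φ (a * a) - Φ a * Φ a‖ := by
    have h := norm_adjoint_comp_le_sqrt_mul_sqrt (R (star b)) (R a)
    rwa [hcov, hcov, hcov, ha, star_star] at h
  calc ‖Φ a * Φ b - Φ b * Φ a‖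
      = ‖(Φ (b * a) - Φ b * Φ a) - (Φ (a * b) - Φ a * Φ b)‖ := by rw [hab]; congr 1; abel
    _ ≤ ‖Φ (b * a) - Φ b * Φ a‖ + ‖Φ (a * b) - Φ a * Φ b‖ := norm_sub_le _ _
    _ ≤ √‖Φ (a * a) - Φ a * Φ a‖ * (√‖Φ (star b * b) - Φ (star b) * Φ b‖ +
          √‖Φ (b * star b) - Φ b * Φ (star b)‖) := by linarith
    _ ≤ _ := by gcongr
end

section
/- Let Φ : B(K) → B(H) be a unital Stinespring-form operation (V*V = 1). Let a, b ∈ B(K) be effects with ab = ba, let F ∈ B(H) be an effect, and set δ := Φ(b) − F. Then ‖[Φ(a), F]‖ ≤ ‖δ‖ + 2 ‖Φ(a) − Φ(a)²‖^{1/2} · ‖Φ(b²) − Φ(b)²‖^{1/2}. (Interpreting Φ(a) as an effect of the measured observable, Φ(b) as the disturbed version of F, and ‖δ‖ as the disturbance, this bounds the non-commutativity of the measured and non-disturbed observables by the disturbance and the unsharpness terms.) -/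
/-- The square of an effect lies below it. -/
theorem ContinuousLinearMap.mul_self_le_of_le_one {H : Type*}
    [NormedAddCommGroup H] [InnerProductSpace ℂ H] [CompleteSpace H]
    {x : H →L[ℂ] H} (h0 : 0 ≤ x) (h1 : x ≤ 1) : x * x ≤ x := by
  have := CStarAlgebra.pow_antitone h0 h1 one_le_two
  simpa [pow_two] using this

/-- The commutator of an operator with an effect is bounded by the norm of the operator. -/
theorem ContinuousLinearMap.norm_commutator_le_of_le_one {H : Type*}
    [NormedAddCommGroup H] [InnerProductSpace ℂ H] [CompleteSpace H]
    {x : H →L[ℂ] H} (h0 : 0 ≤ x) (h1 : x ≤ 1) (d : H →L[ℂ] H) :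
    ‖x * d - d * x‖ ≤ ‖d‖ := by
  set y : H →L[ℂ] H := x + x - 1 with hy
  have hsa : star y = y := by
    simp [hy, (IsSelfAdjoint.of_nonneg h0).star_eq]
  have hyy : star y * y ≤ 1 := by
    have h := ContinuousLinearMap.mul_self_le_of_le_one h0 h1
    have e : star y * y = 1 - 4 • (x - x * x) := by rw [hsa, hy]; noncomm_ring
    rw [e]
    exact sub_le_self _ (nsmul_nonneg (sub_nonneg.2 h) 4)
  have hn : ‖y‖ ≤ 1 := by
    have := (CStarAlgebra.norm_le_one_iff_of_nonneg (star y * y) (star_mul_self_nonneg y)).2 hyy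
    rw [CStarRing.norm_star_mul_self] at this
    nlinarith [norm_nonneg y]
  have e : (2 : ℝ) • (x * d - d * x) = y * d - d * y := by
    rw [hy, two_smul]; noncomm_ring
  have h2 : 2 * ‖x * d - d * x‖ = ‖y * d - d * y‖ := by
    rw [← e, norm_smul]; norm_num
  have h3 := norm_sub_le (y * d) (d * y)
  have h4 := norm_mul_le y d
  have h5 := norm_mul_le d y
  nlinarith [norm_nonneg d]

/-- The defect operators `S V - V (V* S V)` of an isometry `V` have the covariances
`V* (S* T) V - (V* S V)* (V* T V)` as their Gram products. -/
theorem ContinuousLinearMap.adjoint_defect_comp_defect {H M : Type*}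
    [NormedAddCommGroup H] [InnerProductSpace ℂ H] [CompleteSpace H]
    [NormedAddCommGroup M] [InnerProductSpace ℂ M] [CompleteSpace M]
    {V : H →L[ℂ] M} (hV : (adjoint V).comp V = 1) {S T : M →L[ℂ] M} (hS : adjoint S = S) :
    (adjoint (S.comp V - V.comp ((adjoint V).comp (S.comp V)))).comp
        (T.comp V - V.comp ((adjoint V).comp (T.comp V))) =
      (adjoint V).comp ((S * T).comp V) -
        (adjoint V).comp (S.comp V) * (adjoint V).comp (T.comp V) := by
  have h (z : H) : adjoint V (V z) = z := congrArg (fun f : H →L[ℂ] H => f z) hV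
  ext z
  simp [adjoint_comp, hS, h]


/-- Quantitative disturbance bound: the non-commutativity of the measured effect
`Φ(a)` with the target effect `F` is bounded by the disturbance `‖Φ(b) − F‖` and
the unsharpness terms. -/
theorem stmt_11
    {H K M : Type*}
    [NormedAddCommGroup H] [InnerProductSpace ℂ H] [CompleteSpace H]
    [NormedAddCommGroup K] [InnerProductSpace ℂ K] [CompleteSpace K]
    [NormedAddCommGroup M] [InnerProductSpace ℂ M] [CompleteSpace M]
    (π : (K →L[ℂ] K) →⋆ₐ[ℂ] (M →L[ℂ] M))
    (V : H →L[ℂ] M) (hV : ‖V‖ ≤ 1)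
    (hunital : (ContinuousLinearMap.adjoint V).comp V = 1)
    (Φ : (K →L[ℂ] K) → (H →L[ℂ] H))
    (hΦ : ∀ A, Φ A = (ContinuousLinearMap.adjoint V).comp ((π A).comp V))
    (a b : K →L[ℂ] K) (ha0 : 0 ≤ a) (ha1 : a ≤ 1) (hb0 : 0 ≤ b) (hb1 : b ≤ 1)
    (hab : a * b = b * a)
    (F : H →L[ℂ] H) (hF0 : 0 ≤ F) (hF1 : F ≤ 1) :
    ‖Φ a * F - F * Φ a‖ ≤
      ‖Φ b - F‖ +
        2 * (Real.sqrt ‖Φ a - Φ a * Φ a‖ * Real.sqrt ‖Φ (b * b) - Φ b * Φ b‖) := by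
  have hsub (c d : K →L[ℂ] K) : Φ (c - d) = Φ c - Φ d := by
    ext z; simp [hΦ]
  have hone : Φ 1 = 1 := by
    rw [hΦ, map_one]; exact hunital
  have hpos {c : K →L[ℂ] K} (hc : 0 ≤ c) : 0 ≤ Φ c := by
    rw [hΦ, ContinuousLinearMap.nonneg_iff_isPositive]
    exact ((ContinuousLinearMap.nonneg_iff_isPositive _).1 (map_nonneg π hc)).adjoint_conj V
  have hmono {c d : K →L[ℂ] K} (hcd : c ≤ d) : Φ c ≤ Φ d := by
    rw [← sub_nonneg, ← hsub]; exact hpos (sub_nonneg.2 hcd)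
  have hadj {c : K →L[ℂ] K} (hc : 0 ≤ c) : ContinuousLinearMap.adjoint (π c) = π c := by
    rw [← ContinuousLinearMap.star_eq_adjoint, ← map_star, (IsSelfAdjoint.of_nonneg hc).star_eq]
  let D (c : K →L[ℂ] K) : H →L[ℂ] M := (π c).comp V - V.comp (Φ c)
  have hgram {c : K →L[ℂ] K} (hc : 0 ≤ c) (d : K →L[ℂ] K) :
      (ContinuousLinearMap.adjoint (D c)).comp (D d) = Φ (c * d) - Φ c * Φ d := by
    simp only [D, hΦ, map_mul]
    exact ContinuousLinearMap.adjoint_defect_comp_defect hunital (hadj hc)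
  have hnorm {c : K →L[ℂ] K} (hc : 0 ≤ c) : ‖D c‖ = Real.sqrt ‖Φ (c * c) - Φ c * Φ c‖ := by
    rw [← hgram hc, ContinuousLinearMap.norm_adjoint_comp_self,
      Real.sqrt_mul_self (norm_nonneg _)]
  have hDa : ‖D a‖ ≤ Real.sqrt ‖Φ a - Φ a * Φ a‖ := by
    rw [hnorm ha0]
    refine Real.sqrt_le_sqrt (CStarAlgebra.norm_le_norm_of_nonneg_of_le ?_ ?_)
    · rw [← hgram ha0, ContinuousLinearMap.nonneg_iff_isPositive]
      exact ContinuousLinearMap.isPositive_adjoint_comp_self (D a)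
    · exact sub_le_sub_right
        (hmono (ContinuousLinearMap.mul_self_le_of_le_one ha0 ha1)) _
  have hcross {c : K →L[ℂ] K} (hc : 0 ≤ c) (d : K →L[ℂ] K) :
      ‖Φ (c * d) - Φ c * Φ d‖ ≤ ‖D c‖ * ‖D d‖ := by
    rw [← hgram hc]
    refine (ContinuousLinearMap.opNorm_comp_le _ _).trans_eq ?_
    rw [LinearIsometryEquiv.norm_map]
  have hcomm := ContinuousLinearMap.norm_commutator_le_of_le_one (hpos ha0)
    (hone ▸ hmono ha1) (Φ b - F)
  have hsplit : Φ a * F - F * Φ a =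
      (Φ (b * a) - Φ b * Φ a) - (Φ (a * b) - Φ a * Φ b)
        - (Φ a * (Φ b - F) - (Φ b - F) * Φ a) := by
    rw [hab]; noncomm_ring
  have hprod : ‖D a‖ * ‖D b‖ ≤
      Real.sqrt ‖Φ a - Φ a * Φ a‖ * Real.sqrt ‖Φ (b * b) - Φ b * Φ b‖ := by
    rw [← hnorm hb0]
    exact mul_le_mul_of_nonneg_right hDa (norm_nonneg _)
  rw [hsplit]
  refine (norm_sub_le _ _).trans ?_
  have h1 := norm_sub_le (Φ (b * a) - Φ b * Φ a) (Φ (a * b) - Φ a * Φ b)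
  have h2 := hcross ha0 b
  have h3 := hcross hb0 a
  linarith [mul_comm ‖D a‖ ‖D b‖]
end

section
/- Let Φ : B(K) → B(H) be a unital Stinespring-form operation (V*V = 1). Let b ∈ B(K) be an effect, n ∈ B(K) self-adjoint, N_S ∈ B(H) self-adjoint, c ∈ ℝ with Φ(n) = N_S + c·1 (an averaged additive conservation law), F ∈ B(H) an effect, and δ := Φ(b) − F. Then ‖[F, N_S] − Φ([b, n])‖ ≤ 2‖N_S‖·‖δ‖ + 2 ‖Φ(n²) − Φ(n)²‖^{1/2} · ‖Φ(b²) − Φ(b)²‖^{1/2}. (This is the abstract form of the quantitative disturbance bound under an additive conservation law, with Φ the composition of the restriction map Γ_ξ with the conserving interaction channel, b = F(y)⊗1, n the conserved quantity N = N_S⊗1 + 1⊗N_A, and c = tr(N_A ξ).) -/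
open ContinuousLinearMap in
/-- For an isometry `V`, the covariance `V†S†TV - (V†S†V)(V†TV)` of the compressions of `S` and `T`
is the product of their off-diagonal parts. -/
theorem adjoint_offDiagonal_comp_offDiagonal
    {H M : Type*}
    [NormedAddCommGroup H] [InnerProductSpace ℂ H] [CompleteSpace H]
    [NormedAddCommGroup M] [InnerProductSpace ℂ M] [CompleteSpace M]
    (V : H →L[ℂ] M) (hV : (adjoint V).comp V = 1) (S T : M →L[ℂ] M) :
    (adjoint (S.comp V - V.comp ((adjoint V).comp (S.comp V)))).comp
        (T.comp V - V.comp ((adjoint V).comp (T.comp V))) =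
      (adjoint V).comp ((adjoint S * T).comp V) -
        (adjoint V).comp ((adjoint S).comp V) * (adjoint V).comp (T.comp V) := by
  have hV' (x : H) : adjoint V (V x) = x := DFunLike.congr_fun hV x
  ext x
  simp [adjoint_comp, hV', sub_apply, map_sub]

open ContinuousLinearMap in
/-- The off-diagonal part of a self-adjoint operator has norm the square root of the norm of its
variance. -/
theorem norm_offDiagonal_of_isSelfAdjoint
    {H M : Type*}
    [NormedAddCommGroup H] [InnerProductSpace ℂ H] [CompleteSpace H]
    [NormedAddCommGroup M] [InnerProductSpace ℂ M] [CompleteSpace M]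
    (V : H →L[ℂ] M) (hV : (adjoint V).comp V = 1) {S : M →L[ℂ] M} (hS : IsSelfAdjoint S) :
    ‖S.comp V - V.comp ((adjoint V).comp (S.comp V))‖ =
      Real.sqrt ‖(adjoint V).comp ((S * S).comp V) -
        (adjoint V).comp (S.comp V) * (adjoint V).comp (S.comp V)‖ := by
  have h := adjoint_offDiagonal_comp_offDiagonal V hV S S
  rw [hS.adjoint_eq] at h
  rw [← h, norm_adjoint_comp_self, Real.sqrt_mul_self (norm_nonneg _)]

open ContinuousLinearMap in
/-- Cauchy–Schwarz bound for the covariance of two self-adjoint operators. -/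
theorem norm_covariance_le
    {H M : Type*}
    [NormedAddCommGroup H] [InnerProductSpace ℂ H] [CompleteSpace H]
    [NormedAddCommGroup M] [InnerProductSpace ℂ M] [CompleteSpace M]
    (V : H →L[ℂ] M) (hV : (adjoint V).comp V = 1) {S T : M →L[ℂ] M}
    (hS : IsSelfAdjoint S) (hT : IsSelfAdjoint T) :
    ‖(adjoint V).comp ((S * T).comp V) -
        (adjoint V).comp (S.comp V) * (adjoint V).comp (T.comp V)‖ ≤
      Real.sqrt ‖(adjoint V).comp ((S * S).comp V) -
        (adjoint V).comp (S.comp V) * (adjoint V).comp (S.comp V)‖ *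
      Real.sqrt ‖(adjoint V).comp ((T * T).comp V) -
        (adjoint V).comp (T.comp V) * (adjoint V).comp (T.comp V)‖ := by
  have h := adjoint_offDiagonal_comp_offDiagonal V hV S T
  rw [hS.adjoint_eq] at h
  rw [← h, ← norm_offDiagonal_of_isSelfAdjoint V hV hS, ← norm_offDiagonal_of_isSelfAdjoint V hV hT]
  refine (opNorm_comp_le _ _).trans_eq ?_
  rw [LinearIsometryEquiv.norm_map]


/-- Quantitative disturbance bound under an averaged additive conservation law
`Φ(n) = N_S + c·1`. -/
theorem stmt_13
    {H K M : Type*}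
    [NormedAddCommGroup H] [InnerProductSpace ℂ H] [CompleteSpace H]
    [NormedAddCommGroup K] [InnerProductSpace ℂ K] [CompleteSpace K]
    [NormedAddCommGroup M] [InnerProductSpace ℂ M] [CompleteSpace M]
    (π : (K →L[ℂ] K) →⋆ₐ[ℂ] (M →L[ℂ] M))
    (V : H →L[ℂ] M) (hV : ‖V‖ ≤ 1)
    (hunital : (ContinuousLinearMap.adjoint V).comp V = 1)
    (Φ : (K →L[ℂ] K) → (H →L[ℂ] H))
    (hΦ : ∀ A, Φ A = (ContinuousLinearMap.adjoint V).comp ((π A).comp V))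
    (b n : K →L[ℂ] K) (hb0 : 0 ≤ b) (hb1 : b ≤ 1) (hn : IsSelfAdjoint n)
    (N_S : H →L[ℂ] H) (hNS : IsSelfAdjoint N_S) (c : ℝ)
    (hcons : Φ n = N_S + (c : ℂ) • 1)
    (F : H →L[ℂ] H) (hF0 : 0 ≤ F) (hF1 : F ≤ 1) :
    ‖(F * N_S - N_S * F) - Φ (b * n - n * b)‖ ≤
      2 * ‖N_S‖ * ‖Φ b - F‖ +
        2 * (Real.sqrt ‖Φ (n * n) - Φ n * Φ n‖ *
          Real.sqrt ‖Φ (b * b) - Φ b * Φ b‖) := by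
  have hb : IsSelfAdjoint b := .of_nonneg hb0
  have cov {A B : K →L[ℂ] K} (hA : IsSelfAdjoint A) (hB : IsSelfAdjoint B) :
      ‖Φ (A * B) - Φ A * Φ B‖ ≤
        Real.sqrt ‖Φ (A * A) - Φ A * Φ A‖ * Real.sqrt ‖Φ (B * B) - Φ B * Φ B‖ := by
    simpa only [hΦ, map_mul] using norm_covariance_le V hunital (hA.map π) (hB.map π)
  have hsub : Φ (b * n - n * b) = Φ (b * n) - Φ (n * b) := by
    simp only [hΦ, map_sub, ContinuousLinearMap.sub_comp, ContinuousLinearMap.comp_sub]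
  have hN : N_S = Φ n - (c : ℂ) • 1 := by rw [hcons, add_sub_cancel_right]
  have hcomm : Φ b * N_S - N_S * Φ b = Φ b * Φ n - Φ n * Φ b := by
    simp [hN, mul_sub, sub_mul]
  have key : (F * N_S - N_S * F) - Φ (b * n - n * b) =
      (N_S * (Φ b - F) - (Φ b - F) * N_S) +
        ((Φ (n * b) - Φ n * Φ b) - (Φ (b * n) - Φ b * Φ n)) := by
    rw [hsub, mul_sub, sub_mul, ← sub_eq_zero]
    rw [← sub_eq_zero] at hcomm
    rw [← hcomm]
    abel
  have h1 := norm_sub_le (N_S * (Φ b - F)) ((Φ b - F) * N_S)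
  have h2 := norm_sub_le (Φ (n * b) - Φ n * Φ b) (Φ (b * n) - Φ b * Φ n)
  rw [key]
  linarith [norm_add_le (N_S * (Φ b - F) - (Φ b - F) * N_S)
      ((Φ (n * b) - Φ n * Φ b) - (Φ (b * n) - Φ b * Φ n)),
    norm_mul_le N_S (Φ b - F), norm_mul_le (Φ b - F) N_S, cov hn hb, cov hb hn]
end

section
/- Let m, k be positive natural numbers, ξ ∈ Matrix (Fin k) (Fin k) ℂ with trace(ξ) = 1, N_S ∈ Matrix (Fin m) (Fin m) ℂ, N_A ∈ Matrix (Fin k) (Fin k) ℂ, and set N := N_S ⊗ₖ 1 + 1 ⊗ₖ N_A (an additive quantity on the composite system). Define the restriction map Γ_ξ sending B ∈ Matrix ((Fin m) × (Fin k)) ((Fin m) × (Fin k)) ℂ to the m×m matrix with entries (Γ_ξ B) i j := ∑_{p,q} B (i,p) (j,q) · ξ q p. Let Ψ be any map on Matrix ((Fin m) × (Fin k)) ((Fin m) × (Fin k)) ℂ with Ψ(N) = N and Ψ(N·N) = N·N (full conservation of N). Then Γ_ξ(Ψ(N·N)) − (Γ_ξ(Ψ(N)))·(Γ_ξ(Ψ(N)))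 = ( trace(N_A·N_A·ξ) − (trace(N_A·ξ))² ) • 1, i.e., the defect operator equals the variance of N_A in ξ times the identity. -/
open Matrix Kronecker in
/-- Under full conservation of the additive quantity `N = N_S ⊗ 1 + 1 ⊗ N_A`, the
defect `Γ_ξ(Ψ(N²)) − Γ_ξ(Ψ(N))²` equals the variance of `N_A` in `ξ` times `1`. -/
theorem stmt_14
    {m k : ℕ} (hm : 0 < m) (hk : 0 < k)
    (ξ : Matrix (Fin k) (Fin k) ℂ) (hξ : ξ.trace = 1)
    (N_S : Matrix (Fin m) (Fin m) ℂ) (N_A : Matrix (Fin k) (Fin k) ℂ)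
    (N : Matrix (Fin m × Fin k) (Fin m × Fin k) ℂ)
    (hN : N = N_S ⊗ₖ (1 : Matrix (Fin k) (Fin k) ℂ) +
      (1 : Matrix (Fin m) (Fin m) ℂ) ⊗ₖ N_A)
    (Γ : Matrix (Fin m × Fin k) (Fin m × Fin k) ℂ → Matrix (Fin m) (Fin m) ℂ)
    (hΓ : ∀ B, Γ B = Matrix.of fun i j => ∑ p, ∑ q, B (i, p) (j, q) * ξ q p)
    (Ψ : Matrix (Fin m × Fin k) (Fin m × Fin k) ℂ →
      Matrix (Fin m × Fin k) (Fin m × Fin k) ℂ)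
    (hΨ1 : Ψ N = N) (hΨ2 : Ψ (N * N) = N * N) :
    Γ (Ψ (N * N)) - Γ (Ψ N) * Γ (Ψ N) =
      ((N_A * N_A * ξ).trace - (N_A * ξ).trace ^ 2) • (1 : Matrix (Fin m) (Fin m) ℂ) := by
  have hΓ_add : ∀ A B, Γ (A + B) = Γ A + Γ B := by
    intro A B
    ext i j
    simp [hΓ, add_mul, Finset.sum_add_distrib]
  have hΓ_kronecker : ∀ (X : Matrix (Fin m) (Fin m) ℂ) (Y : Matrix (Fin k) (Fin k) ℂ),
      Γ (X ⊗ₖ Y) = (Y * ξ).trace • X := by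
    intro X Y
    ext i j
    simp only [hΓ, of_apply, kroneckerMap_apply, Matrix.smul_apply, smul_eq_mul, trace,
      diag_apply, mul_apply, Finset.sum_mul]
    refine Finset.sum_congr rfl fun p _ => Finset.sum_congr rfl fun q _ => ?_
    ring
  rw [hΨ1, hΨ2, hN]
  simp only [add_mul, mul_add, ← mul_kronecker_mul, one_mul, mul_one, hΓ_add, hΓ_kronecker, hξ,
    smul_mul_assoc, mul_smul_comm, one_smul]
  module
end

section
/- Let Φ : B(K) → B(H) be a unital Stinespring-form operation (V*V = 1). Let z ∈ B(K) be an effect, n ∈ B(K) self-adjoint, N_S ∈ B(H) self-adjoint, c ∈ ℝ with Φ(n) = N_S + c·1 (an averaged additive conservation law), E ∈ B(H) an effect, and ε := Φ(z) − E. Then ‖[E, N_S] − Φ([z, n])‖ ≤ 2‖N_S‖·‖ε‖ + 2 ‖Φ(n²) − Φ(n)²‖^{1/2} · ( 2‖ε‖ + ‖E − E²‖ )^{1/2}. (This is the abstract measurability bound: E is the target observable effect, Φ(z) the actually measured effect with z = 1⊗Z(x) the pointer effect, and ‖ε‖ the measurement error.) -/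
open ContinuousLinearMap in
/-- The defect of multiplicativity of a compression `X ↦ V* X V` by an isometry factors through
the projection onto the orthogonal complement of the range of `V`. -/
theorem adjoint_comp_compl_range_proj {H M : Type*}
    [NormedAddCommGroup H] [InnerProductSpace ℂ H] [CompleteSpace H]
    [NormedAddCommGroup M] [InnerProductSpace ℂ M] [CompleteSpace M]
    (V : H →L[ℂ] M) (hV : (adjoint V).comp V = 1)
    (X Y : M →L[ℂ] M) (hX : IsSelfAdjoint X) :
    (adjoint (X.comp V - V.comp ((adjoint V).comp (X.comp V)))).comp
        (Y.comp V - V.comp ((adjoint V).comp (Y.comp V))) =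
      (adjoint V).comp ((X * Y).comp V) -
        (adjoint V).comp (X.comp V) * (adjoint V).comp (Y.comp V) := by
  have hVV : ∀ x, adjoint V (V x) = x := fun x => by
    simpa using congrArg (fun T : H →L[ℂ] H => T x) hV
  have hX' : adjoint X = X := hX
  ext x
  simp [adjoint_comp, hX', hVV]

/-- The square of an effect is below the effect. -/
theorem mul_self_le_self_of_effect {A : Type*} [Ring A] [StarRing A] [PartialOrder A]
    [StarOrderedRing A] {a : A} (h0 : 0 ≤ a) (h1 : a ≤ 1) : a * a ≤ a := by
  have hs : star a = a := (IsSelfAdjoint.of_nonneg h0)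
  have hs' : star (1 - a) = 1 - a := by simp [hs]
  have e1 := star_left_conjugate_nonneg (sub_nonneg.2 h1) a
  have e2 := star_left_conjugate_nonneg h0 (1 - a)
  rw [hs] at e1
  rw [hs'] at e2
  have e : a - a * a = a * (1 - a) * a + (1 - a) * a * (1 - a) := by noncomm_ring
  rw [← sub_nonneg, e]
  exact add_nonneg e1 e2

/-- The unsharpness `F - F²` changes by at most twice the distance between two effects. -/
theorem norm_sub_mul_self_le {A : Type*} [CStarAlgebra A] [PartialOrder A]
    [StarOrderedRing A] {E F : A} (hE0 : 0 ≤ E) (hE1 : E ≤ 1) (hF0 : 0 ≤ F) (hF1 : F ≤ 1) :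
    ‖F - F * F‖ ≤ 2 * ‖F - E‖ + ‖E - E * E‖ := by
  have hF : ‖F‖ ≤ 1 := (CStarAlgebra.norm_le_one_iff_of_nonneg F hF0).2 hF1
  have hE : ‖1 - E‖ ≤ 1 := (CStarAlgebra.norm_le_one_iff_of_nonneg _ (sub_nonneg.2 hE1)).2
    (sub_le_self _ hE0)
  have e : F - F * F = (F - E) * (1 - E) - F * (F - E) + (E - E * E) := by noncomm_ring
  have h1 : ‖(F - E) * (1 - E)‖ ≤ ‖F - E‖ :=
    (norm_mul_le _ _).trans (mul_le_of_le_one_right (norm_nonneg _) hE)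
  have h2 : ‖F * (F - E)‖ ≤ ‖F - E‖ :=
    (norm_mul_le _ _).trans (mul_le_of_le_one_left (norm_nonneg _) hF)
  rw [e]
  have h3 := norm_add_le ((F - E) * (1 - E) - F * (F - E)) (E - E * E)
  have h4 := norm_sub_le ((F - E) * (1 - E)) (F * (F - E))
  linarith

/-- The norm of a commutator is at most twice the product of the norms. -/
theorem norm_mul_sub_mul_le {A : Type*} [NormedRing A] (a b : A) :
    ‖a * b - b * a‖ ≤ 2 * ‖b‖ * ‖a‖ := by
  have h1 := norm_sub_le (a * b) (b * a)
  have h2 := norm_mul_le a b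
  have h3 := norm_mul_le b a
  nlinarith

/-- Measurability bound under an averaged additive conservation law: the deviation of
`[E, N_S]` from `Φ([z,n])` is bounded by the measurement error and unsharpness terms. -/
theorem stmt_15
    {H K M : Type*}
    [NormedAddCommGroup H] [InnerProductSpace ℂ H] [CompleteSpace H]
    [NormedAddCommGroup K] [InnerProductSpace ℂ K] [CompleteSpace K]
    [NormedAddCommGroup M] [InnerProductSpace ℂ M] [CompleteSpace M]
    (π : (K →L[ℂ] K) →⋆ₐ[ℂ] (M →L[ℂ] M))
    (V : H →L[ℂ] M) (hV : ‖V‖ ≤ 1)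
    (hunital : (ContinuousLinearMap.adjoint V).comp V = 1)
    (Φ : (K →L[ℂ] K) → (H →L[ℂ] H))
    (hΦ : ∀ A, Φ A = (ContinuousLinearMap.adjoint V).comp ((π A).comp V))
    (z n : K →L[ℂ] K) (hz0 : 0 ≤ z) (hz1 : z ≤ 1) (hn : IsSelfAdjoint n)
    (N_S : H →L[ℂ] H) (hNS : IsSelfAdjoint N_S) (c : ℝ)
    (hcons : Φ n = N_S + (c : ℂ) • 1)
    (E : H →L[ℂ] H) (hE0 : 0 ≤ E) (hE1 : E ≤ 1) :
    ‖(E * N_S - N_S * E) - Φ (z * n - n * z)‖ ≤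
      2 * ‖N_S‖ * ‖Φ z - E‖ +
        2 * (Real.sqrt ‖Φ (n * n) - Φ n * Φ n‖ *
          Real.sqrt (2 * ‖Φ z - E‖ + ‖E - E * E‖)) := by
  set W := ContinuousLinearMap.adjoint V
  have hπn : IsSelfAdjoint (π n) := hn.map π
  have hπz0 : 0 ≤ π z := map_nonneg π hz0
  have hπz1 : π z ≤ 1 := by simpa using OrderHomClass.mono π hz1
  have hπz : IsSelfAdjoint (π z) := IsSelfAdjoint.of_nonneg hπz0
  have mono : ∀ X Y : M →L[ℂ] M, X ≤ Y → W.comp (X.comp V) ≤ W.comp (Y.comp V) := by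
    intro X Y h
    rw [ContinuousLinearMap.le_def] at h ⊢
    simpa [ContinuousLinearMap.comp_sub, ContinuousLinearMap.sub_comp] using h.adjoint_conj V
  have hF0 : 0 ≤ Φ z := by simpa [hΦ] using mono _ _ hπz0
  have hF1 : Φ z ≤ 1 := by
    have h := mono _ _ hπz1
    rwa [ContinuousLinearMap.one_def, ContinuousLinearMap.id_comp, hunital, ← hΦ] at h
  let D : (M →L[ℂ] M) → (H →L[ℂ] M) := fun X => X.comp V - V.comp (W.comp (X.comp V))
  have key : ∀ a b, IsSelfAdjoint (π a) →
      (ContinuousLinearMap.adjoint (D (π a))).comp (D (π b)) = Φ (a * b) - Φ a * Φ b := by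
    intro a b ha
    rw [hΦ, hΦ a, hΦ b, map_mul]
    exact adjoint_comp_compl_range_proj V hunital _ _ ha
  have norm_eq : ∀ a, IsSelfAdjoint (π a) → ‖D (π a)‖ = √‖Φ (a * a) - Φ a * Φ a‖ := by
    intro a ha
    rw [← key a a ha, ContinuousLinearMap.norm_adjoint_comp_self,
      Real.sqrt_mul_self (norm_nonneg _)]
  have hA : ‖D (π z)‖ ≤ √(2 * ‖Φ z - E‖ + ‖E - E * E‖) := by
    rw [norm_eq z hπz]
    refine Real.sqrt_le_sqrt (le_trans ?_ (norm_sub_mul_self_le hE0 hE1 hF0 hF1))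
    refine CStarAlgebra.norm_le_norm_of_nonneg_of_le ?_ ?_
    · rw [← key z z hπz, ContinuousLinearMap.nonneg_iff_isPositive]
      exact ContinuousLinearMap.isPositive_adjoint_comp_self _
    · refine sub_le_sub_right ?_ _
      rw [hΦ, hΦ z, map_mul]
      exact mono _ _ (mul_self_le_self_of_effect hπz0 hπz1)
  have hsub : Φ (z * n - n * z) = Φ (z * n) - Φ (n * z) := by
    simp [hΦ, ContinuousLinearMap.comp_sub, ContinuousLinearMap.sub_comp]
  have split : (E * N_S - N_S * E) - Φ (z * n - n * z) =
      -((Φ z - E) * N_S - N_S * (Φ z - E)) -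
        ((ContinuousLinearMap.adjoint (D (π z))).comp (D (π n)) -
          (ContinuousLinearMap.adjoint (D (π n))).comp (D (π z))) := by
    rw [key z n hπz, key n z hπn, hsub, hcons]
    simp only [mul_add, add_mul, mul_sub, sub_mul, mul_smul_comm, smul_mul_assoc, mul_one,
      one_mul]
    abel
  have hcomm : ∀ S T : H →L[ℂ] M, ‖(ContinuousLinearMap.adjoint S).comp T‖ ≤ ‖S‖ * ‖T‖ := by
    intro S T
    simpa using ContinuousLinearMap.opNorm_comp_le (ContinuousLinearMap.adjoint S) T
  have h1 := norm_mul_sub_mul_le (Φ z - E) N_S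
  have h2 := hcomm (D (π z)) (D (π n))
  have h3 := hcomm (D (π n)) (D (π z))
  have h4 := mul_le_mul_of_nonneg_left hA (norm_nonneg (D (π n)))
  rw [split, ← norm_eq n hπn]
  refine (norm_sub_le _ _).trans (add_le_add (by rwa [norm_neg]) ?_)
  refine (norm_sub_le _ _).trans ?_
  linarith [mul_comm ‖D (π z)‖ ‖D (π n)‖]
end

section
/- Let Φ : B(K) → B(H) be a unital Stinespring-form operation (V*V = 1). Let z ∈ B(K) be an effect, n ∈ B(K) self-adjoint with zn = nz (the Yanase condition), N_S ∈ B(H) self-adjoint, and c ∈ ℝ with Φ(n) = N_S + c·1 (an averaged additive conservation law). Set E := Φ(z). Then ‖[E, N_S]‖ ≤ 2 ‖Φ(n²) − Φ(n)²‖^{1/2} · ‖E − E²‖^{1/2}. In particular, if E is a projection then E commutes with N_S. (This is the generalized Wigner–Araki–Yanase bound: an accurately measured observable not commuting with the system part N_S of the conserved quantity must be unsharp, with non-commutativity controlled by the unsharpness and the conserved-quantity fluctuation term.) -/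
open ContinuousLinearMap

/-- The defect `π(a)V - V(V*π(a)V)` of an isometric dilation has the covariance
`V*π(a*b)V - (V*π(a)V)*(V*π(b)V)` as its Gram operator. -/
theorem adjoint_defect_comp_defect
    {H M A : Type*}
    [NormedAddCommGroup H] [InnerProductSpace ℂ H] [CompleteSpace H]
    [NormedAddCommGroup M] [InnerProductSpace ℂ M] [CompleteSpace M]
    [Semiring A] [StarRing A] [Algebra ℂ A]
    (π : A →⋆ₐ[ℂ] (M →L[ℂ] M)) (V : H →L[ℂ] M) (hV : adjoint V ∘L V = 1)
    (Φ : A → (H →L[ℂ] H)) (hΦ : ∀ a, Φ a = adjoint V ∘L (π a ∘L V)) (a b : A)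
    (ha : IsSelfAdjoint a) :
    adjoint (π a ∘L V - V ∘L Φ a) ∘L (π b ∘L V - V ∘L Φ b) = Φ (a * b) - Φ a * Φ b := by
  have hπ : adjoint (π a) = π a := by
    rw [← star_eq_adjoint, ← map_star, ha.star_eq]
  have hadj : adjoint (Φ a) = Φ a := by
    rw [hΦ, adjoint_comp, adjoint_comp, adjoint_adjoint, hπ]
    rfl
  have hVx : ∀ x, adjoint V (V x) = x := fun x => congr($hV x)
  have hΦx : ∀ c x, adjoint V (π c (V x)) = Φ c x := fun c x => by rw [hΦ]; rfl
  rw [map_sub, adjoint_comp, adjoint_comp, hπ, hadj]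
  ext x
  have hab : adjoint V (π a (π b (V x))) = Φ (a * b) x := by
    rw [← hΦx, map_mul]
    rfl
  simp [hVx, hΦx, hab]

/-- A compression of a star-homomorphism maps nonnegative operators to nonnegative operators. -/
theorem compression_nonneg
    {H K M : Type*}
    [NormedAddCommGroup H] [InnerProductSpace ℂ H] [CompleteSpace H]
    [NormedAddCommGroup K] [InnerProductSpace ℂ K] [CompleteSpace K]
    [NormedAddCommGroup M] [InnerProductSpace ℂ M] [CompleteSpace M]
    (π : (K →L[ℂ] K) →⋆ₐ[ℂ] (M →L[ℂ] M)) (V : H →L[ℂ] M) {a : K →L[ℂ] K} (ha : 0 ≤ a) :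
    0 ≤ adjoint V ∘L (π a ∘L V) := by
  have h : 0 ≤ π a := map_nonneg π ha
  rw [nonneg_iff_isPositive] at h ⊢
  exact h.adjoint_conj V

/-- Generalized Wigner–Araki–Yanase bound: under the Yanase condition `zn = nz` and
an averaged additive conservation law, the non-commutativity of the measured
observable `E = Φ(z)` with `N_S` is controlled by its unsharpness; in particular a
projection-valued `E` must commute with `N_S`. -/
theorem stmt_16
    {H K M : Type*}
    [NormedAddCommGroup H] [InnerProductSpace ℂ H] [CompleteSpace H]
    [NormedAddCommGroup K] [InnerProductSpace ℂ K] [CompleteSpace K]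
    [NormedAddCommGroup M] [InnerProductSpace ℂ M] [CompleteSpace M]
    (π : (K →L[ℂ] K) →⋆ₐ[ℂ] (M →L[ℂ] M))
    (V : H →L[ℂ] M) (hV : ‖V‖ ≤ 1)
    (hunital : (ContinuousLinearMap.adjoint V).comp V = 1)
    (Φ : (K →L[ℂ] K) → (H →L[ℂ] H))
    (hΦ : ∀ A, Φ A = (ContinuousLinearMap.adjoint V).comp ((π A).comp V))
    (z n : K →L[ℂ] K) (hz0 : 0 ≤ z) (hz1 : z ≤ 1) (hn : IsSelfAdjoint n)
    (hzn : z * n = n * z)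
    (N_S : H →L[ℂ] H) (hNS : IsSelfAdjoint N_S) (c : ℝ)
    (hcons : Φ n = N_S + (c : ℂ) • 1) :
    (‖Φ z * N_S - N_S * Φ z‖ ≤
      2 * (Real.sqrt ‖Φ (n * n) - Φ n * Φ n‖ * Real.sqrt ‖Φ z - Φ z * Φ z‖)) ∧
    (Φ z * Φ z = Φ z → Φ z * N_S = N_S * Φ z) := by
  have hz : IsSelfAdjoint z := .of_nonneg hz0
  set Wz := (π z).comp V - V.comp (Φ z) with hWz
  set Wn := (π n).comp V - V.comp (Φ n) with hWn
  have gram := adjoint_defect_comp_defect π V hunital Φ hΦ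
  have hcomm : Φ z * N_S - N_S * Φ z = adjoint Wn ∘L Wz - adjoint Wz ∘L Wn := by
    rw [gram n z hn, gram z n hz, hzn, eq_sub_of_add_eq hcons.symm]
    simp only [mul_sub, sub_mul, mul_smul_comm, smul_mul_assoc, mul_one, one_mul]
    abel
  have hWn_norm : ‖Wn‖ = √‖Φ (n * n) - Φ n * Φ n‖ := by
    rw [← gram n n hn, norm_adjoint_comp_self, Real.sqrt_mul_self (norm_nonneg _)]
  have hWz_norm : ‖Wz‖ ≤ √‖Φ z - Φ z * Φ z‖ := by
    refine Real.le_sqrt_of_sq_le ?_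
    rw [pow_two, ← norm_adjoint_comp_self, gram z z hz]
    refine CStarAlgebra.norm_le_norm_of_nonneg_of_le ?_ ?_
    · rw [← gram z z hz, nonneg_iff_isPositive]
      exact isPositive_adjoint_comp_self _
    · refine sub_le_sub_right ?_ _
      have hzz : 0 ≤ z - z * z := by
        have h : 0 ≤ z * (1 - z) :=
          Commute.mul_nonneg hz0 (sub_nonneg.2 hz1) ((Commute.one_right z).sub_right (.refl z))
        rwa [mul_sub, mul_one] at h
      have h := compression_nonneg π V hzz
      rw [map_sub, sub_comp, comp_sub, ← hΦ, ← hΦ] at h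
      exact sub_nonneg.1 h
  have bound : ‖Φ z * N_S - N_S * Φ z‖ ≤
      2 * (Real.sqrt ‖Φ (n * n) - Φ n * Φ n‖ * Real.sqrt ‖Φ z - Φ z * Φ z‖) := by
    rw [hcomm, ← hWn_norm]
    calc ‖adjoint Wn ∘L Wz - adjoint Wz ∘L Wn‖
        ≤ ‖adjoint Wn‖ * ‖Wz‖ + ‖adjoint Wz‖ * ‖Wn‖ :=
          (norm_sub_le _ _).trans (add_le_add (opNorm_comp_le _ _) (opNorm_comp_le _ _))
      _ = 2 * (‖Wn‖ * ‖Wz‖) := by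
          rw [LinearIsometryEquiv.norm_map, LinearIsometryEquiv.norm_map]
          ring
      _ ≤ 2 * (‖Wn‖ * √‖Φ z - Φ z * Φ z‖) := by gcongr
  refine ⟨bound, fun hproj => ?_⟩
  rw [hproj, sub_self, norm_zero, Real.sqrt_zero, mul_zero, mul_zero] at bound
  exact sub_eq_zero.1 (norm_le_zero_iff.1 bound)
end

section
/- Let Φ : B(H) → B(H) be a positive linear map (A ≥ 0 implies Φ(A) ≥ 0), set E := Φ(1), and assume E ≤ 1, Φ(E) = E (the repeatability condition for the operation associated with outcome x), and E ≠ 0. Then ‖E‖ = 1, i.e., every non-zero effect of an observable admitting a repeatable measurement has norm one. -/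
/-- Every non-zero effect of an observable admitting a repeatable measurement has
norm one: for a positive linear map `Φ` with `E := Φ(1) ≤ 1`, `Φ(E) = E` and
`E ≠ 0`, one has `‖E‖ = 1`. -/
theorem stmt_17
    {H : Type*} [NormedAddCommGroup H] [InnerProductSpace ℂ H] [CompleteSpace H]
    (Φ : (H →L[ℂ] H) →ₗ[ℂ] (H →L[ℂ] H))
    (hpos : ∀ A : H →L[ℂ] H, 0 ≤ A → 0 ≤ Φ A)
    (hsub : Φ 1 ≤ 1)
    (hfix : Φ (Φ 1) = Φ 1)
    (hne : Φ 1 ≠ 0) :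
    ‖Φ 1‖ = 1 := by
  have hE : 0 ≤ Φ 1 := hpos 1 zero_le_one
  have : Nontrivial (H →L[ℂ] H) := ⟨_, _, hne⟩
  have hle : ‖Φ 1‖ ≤ 1 := by
    simpa using CStarAlgebra.norm_le_norm_of_nonneg_of_le hE hsub
  have hbound : Φ 1 ≤ (‖Φ 1‖ : ℂ) • (1 : H →L[ℂ] H) := by
    simpa [Algebra.algebraMap_eq_smul_one] using
      (IsSelfAdjoint.of_nonneg hE).le_algebraMap_norm_self
  have himage : Φ 1 ≤ (‖Φ 1‖ : ℂ) • Φ 1 := by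
    have h := hpos _ (sub_nonneg.mpr hbound)
    rwa [map_sub, map_smul, hfix, sub_nonneg] at h
  have hsq : ‖Φ 1‖ ≤ ‖Φ 1‖ * ‖Φ 1‖ := by
    simpa [norm_smul] using CStarAlgebra.norm_le_norm_of_nonneg_of_le hE himage
  have hnorm : 0 < ‖Φ 1‖ := norm_pos_iff.mpr hne
  exact hle.antisymm (le_of_mul_le_mul_right (by simpa using hsq) hnorm)
end

section
/- Let A be a unital C*-algebra and E, N ∈ A self-adjoint elements. If the double commutator vanishes, [E, [E, N]] = 0 (i.e., E·(EN − NE) = (EN − NE)·E), then [E, N] = 0, i.e., EN = NE. (Proved by conjugating N with the unitaries e^{itE} and using that ‖e^{itE} N e^{−itE} − N‖ = |t|·‖[E,N]‖ is bounded by 2‖N‖ for all real t.) -/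
/-- If `X` commutes with `[X, N]`, then conjugating `N` by `exp (t X)` translates it by
`t [X, N]`. -/
lemma exp_smul_mul_mul_exp_neg_smul {A : Type*} [NormedRing A] [NormedAlgebra ℝ A]
    [CompleteSpace A] (X N : A) (h : Commute X (X * N - N * X)) (t : ℝ) :
    NormedSpace.exp (t • X) * N * NormedSpace.exp (t • -X) = N + t • (X * N - N * X) := by
  have hderiv (s : ℝ) : HasDerivAt
      (fun s : ℝ => NormedSpace.exp (s • X) * N * NormedSpace.exp (s • -X)
        - s • (X * N - N * X)) 0 s := by
    have h₁ := hasDerivAt_exp_smul_const (𝕂 := ℝ) X s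
    have h₂ := hasDerivAt_exp_smul_const' (𝕂 := ℝ) (-X) s
    have h₃ := ((h₁.mul_const N).mul h₂).sub ((hasDerivAt_id s).smul_const (X * N - N * X))
    refine h₃.congr_deriv ?_
    have hinv : NormedSpace.exp (s • X) * NormedSpace.exp (s • -X) = 1 := by
      let _ : NormedAlgebra ℚ A := NormedAlgebra.restrictScalars ℚ ℝ A
      rw [smul_neg, ← NormedSpace.exp_add_of_commute (Commute.neg_right (Commute.refl _)),
        add_neg_cancel, NormedSpace.exp_zero]
    have hcomm : NormedSpace.exp (s • X) * (X * N - N * X)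
        = (X * N - N * X) * NormedSpace.exp (s • X) :=
      (h.smul_left s).exp_left
    calc _ = NormedSpace.exp (s • X) * (X * N - N * X) * NormedSpace.exp (s • -X)
          - (X * N - N * X) := by rw [one_smul]; noncomm_ring
      _ = 0 := by rw [hcomm, mul_assoc, hinv, mul_one, sub_self]
  have hconst := is_const_of_deriv_eq_zero (fun s => (hderiv s).differentiableAt)
    (fun s => (hderiv s).deriv) t 0
  simp only [zero_smul, NormedSpace.exp_zero, one_mul, mul_one, sub_zero] at hconst
  exact sub_eq_iff_eq_add.mp hconst

/-- A vector all of whose real multiples are bounded by a common constant is zero. -/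
lemma eq_zero_of_forall_norm_smul_le {V : Type*} [NormedAddCommGroup V] [NormedSpace ℝ V]
    {v : V} {C : ℝ} (h : ∀ t : ℝ, ‖t • v‖ ≤ C) : v = 0 := by
  by_contra hv
  have hpos : 0 < ‖v‖ := norm_pos_iff.mpr hv
  have hle := h ((|C| + 1) / ‖v‖)
  rw [norm_smul, Real.norm_of_nonneg (by positivity), div_mul_cancel₀ _ hpos.ne'] at hle
  linarith [le_abs_self C]

/-- In a unital C*-algebra, if the double commutator `[E,[E,N]]` of self-adjoint
elements vanishes, then `[E,N] = 0`. -/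
theorem stmt_19
    {A : Type*} [NormedRing A] [StarRing A] [CStarRing A]
    [NormedAlgebra ℂ A] [CompleteSpace A] [StarModule ℂ A]
    (E N : A) (hE : IsSelfAdjoint E) (hN : IsSelfAdjoint N)
    (h : E * (E * N - N * E) = (E * N - N * E) * E) :
    E * N = N * E := by
  have hcommutator : (Complex.I • E) * N - N * (Complex.I • E)
      = Complex.I • (E * N - N * E) := by
    rw [smul_mul_assoc, mul_smul_comm, smul_sub]
  have hX : Commute (Complex.I • E) ((Complex.I • E) * N - N * (Complex.I • E)) := by
    rw [hcommutator]
    exact (Commute.smul_right (show Commute E (E * N - N * E) from h) _).smul_left _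
  have hunitary (t : ℝ) : NormedSpace.exp (t • Complex.I • E) ∈ unitary A := by
    convert (selfAdjoint.expUnitary (t • ⟨E, hE⟩)).2 using 1
    rw [selfAdjoint.expUnitary_coe, smul_comm]
    rfl
  have hbound (t : ℝ) : ‖t • (Complex.I • (E * N - N * E))‖ ≤ ‖N‖ + ‖N‖ := by
    have hconj := exp_smul_mul_mul_exp_neg_smul _ N hX t
    have hneg : NormedSpace.exp (t • -(Complex.I • E)) ∈ unitary A := by
      simpa only [neg_smul, smul_neg] using hunitary (-t)
    rw [hcommutator] at hconj
    rw [← sub_eq_iff_eq_add'.mpr hconj]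
    refine (norm_sub_le _ _).trans (add_le_add_left (le_of_eq ?_) _)
    rw [CStarRing.norm_mul_mem_unitary _ hneg, CStarRing.norm_mem_unitary_mul _ (hunitary t)]
  have hzero := eq_zero_of_forall_norm_smul_le hbound
  exact sub_eq_zero.mp ((smul_eq_zero.mp hzero).resolve_left Complex.I_ne_zero)
end
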